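/- Let H be a finite-dimensional real inner product space, ‖·‖♯ a norm on H with dual norm ‖·‖♦, and Φ : H → ℝ^M linear. Let κ ∈ (0,1), λ > 0, x♮ ∈ H, and ω ∈ ℝ^M with ‖Φᵀω‖♦ ≤ κλ. If x* minimizes x ↦ (1/2)‖Φx − (Φx♮ + ω)‖₂² + λ‖x‖♯ and z = x* − x♮, then ‖Φz‖₂² ≤ (1+κ)λ‖z‖♯. -/

import Mathlib

noncomputable section

open scoped RealInnerProductSpace

variable {H : Type*} [NormedAddCommGroup H] [InnerProductSpace ℝ H] [FiniteDimensional ℝ H]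

/-- `sharp` is a norm on `H`. -/
structure IsNormOn (sharp : H → ℝ) : Prop where
  triangle : ∀ x y : H, sharp (x + y) ≤ sharp x + sharp y
  smul_eq : ∀ (c : ℝ) (x : H), sharp (c • x) = |c| * sharp x
  eq_zero_of : ∀ x : H, sharp x = 0 → x = 0

/-- The dual norm of `sharp`: `‖u‖♦ = sup {|⟨u,v⟩| : ‖v‖♯ ≤ 1}`. -/
def dualNorm (sharp : H → ℝ) (u : H) : ℝ :=
  sSup {r : ℝ | ∃ v : H, sharp v ≤ 1 ∧ r = |⟪u, v⟫|}

/-- The subdifferential of `f` at `x`. -/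
def subdiff (f : H → ℝ) (x : H) : Set H :=
  {u : H | ∀ y : H, f y ≥ f x + ⟪u, y - x⟫}

/-- `(H, A, sharp)` is a compressed sensing space with bound `L`. -/
structure IsCSSpace (A : Set H) (sharp : H → ℝ) (L : ℝ) : Prop where
  zero_mem : (0 : H) ∈ A
  decomp : ∀ a ∈ A, ∀ v : H, ∃ z₁ z₂ : H, v = z₁ + z₂ ∧
    sharp (a + z₁) = sharp a + sharp z₁ ∧ sharp z₂ ≤ L * ‖v‖

/-- `Φ` satisfies the `(ρ, α)`-robust width property over the unit `sharp`-ball. -/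
def RobustWidth {M : ℕ} (Φ : H →ₗ[ℝ] EuclideanSpace ℝ (Fin M)) (sharp : H → ℝ)
    (ρ α : ℝ) : Prop :=
  ∀ x : H, ‖Φ x‖ < α * ‖x‖ → ‖x‖ ≤ ρ * sharp x

/-- Every linear functional on a finite-dimensional space is bounded with respect to any norm. -/
theorem LinearMap.exists_abs_le_mul_of_finiteDimensional {V : Type*} [AddCommGroup V] [Module ℝ V]
    [FiniteDimensional ℝ V] (p : V → ℝ) (triangle : ∀ x y, p (x + y) ≤ p x + p y)
    (smul_eq : ∀ (c : ℝ) (x : V), p (c • x) = |c| * p x) (eq_zero_of : ∀ x, p x = 0 → x = 0)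
    (f : V →ₗ[ℝ] ℝ) : ∃ C, ∀ v, |f v| ≤ C * p v := by
  let n : AddGroupNorm V :=
    { toFun := p
      map_zero' := by simpa using smul_eq 0 0
      add_le' := triangle
      neg' := fun x => by simpa using smul_eq (-1) x
      eq_zero_of_map_eq_zero' := eq_zero_of }
  let : NormedAddCommGroup V := n.toNormedAddCommGroup
  let : NormedSpace ℝ V := ⟨fun c x => (smul_eq c x).le⟩
  exact ⟨‖LinearMap.toContinuousLinearMap f‖,
    fun v => (LinearMap.toContinuousLinearMap f).le_opNorm v⟩

namespace IsNormOn

theorem nonneg {E : Type*} [NormedAddCommGroup E] [InnerProductSpace ℝ E] {sharp : E → ℝ}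
    (hs : IsNormOn sharp) (x : E) : 0 ≤ sharp x := by
  have h0 : sharp 0 = 0 := by simpa using hs.smul_eq 0 0
  have hneg : sharp (-x) = sharp x := by simpa using hs.smul_eq (-1) x
  have h := hs.triangle x (-x)
  rw [add_neg_cancel] at h
  linarith

variable {sharp : H → ℝ}

theorem bddAbove_dualNorm (hs : IsNormOn sharp) (u : H) :
    BddAbove {r : ℝ | ∃ v : H, sharp v ≤ 1 ∧ r = |⟪u, v⟫|} := by
  obtain ⟨C, hC⟩ := LinearMap.exists_abs_le_mul_of_finiteDimensional sharp hs.triangle hs.smul_eq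
    hs.eq_zero_of (innerₗ H u)
  refine ⟨|C|, ?_⟩
  rintro r ⟨v, hv, rfl⟩
  calc |⟪u, v⟫| ≤ C * sharp v := hC v
    _ ≤ |C| * sharp v := mul_le_mul_of_nonneg_right (le_abs_self C) (hs.nonneg v)
    _ ≤ |C| := mul_le_of_le_one_right (abs_nonneg C) hv

theorem abs_inner_le_dualNorm_mul (hs : IsNormOn sharp) (u v : H) :
    |⟪u, v⟫| ≤ dualNorm sharp u * sharp v := by
  rcases (hs.nonneg v).eq_or_lt with h | h
  · rw [← h, hs.eq_zero_of v h.symm, inner_zero_right, abs_zero, mul_zero]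
  · rw [← div_le_iff₀ h]
    refine le_csSup (hs.bddAbove_dualNorm u) ⟨(sharp v)⁻¹ • v, ?_, ?_⟩
    · rw [hs.smul_eq, abs_of_pos (inv_pos.2 h), inv_mul_cancel₀ h.ne']
    · rw [real_inner_smul_right, abs_mul, abs_of_pos (inv_pos.2 h), div_eq_inv_mul]

end IsNormOn

/-- First-order optimality of `xstar` in the direction `-z`. -/
theorem norm_sq_le_inner_add_of_forall_le {E F : Type*} [NormedAddCommGroup E]
    [InnerProductSpace ℝ E] [NormedAddCommGroup F] [InnerProductSpace ℝ F] {sharp : E → ℝ}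
    (hs : IsNormOn sharp) (Φ : E →ₗ[ℝ] F) {lam : ℝ} (hlam : 0 ≤ lam) (xstar z : E) (w : F)
    (hmin : ∀ x : E,
      (1 / 2) * ‖Φ xstar - (Φ (xstar - z) + w)‖ ^ 2 + lam * sharp xstar ≤
        (1 / 2) * ‖Φ x - (Φ (xstar - z) + w)‖ ^ 2 + lam * sharp x) :
    ‖Φ z‖ ^ 2 ≤ ⟪Φ z, w⟫ + lam * sharp z := by
  have key : ∀ t : ℝ, 0 < t →
      ‖Φ z‖ ^ 2 - t / 2 * ‖Φ z‖ ^ 2 ≤ ⟪Φ z, w⟫ + lam * sharp z := by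
    intro t ht
    have h := hmin (xstar + (-t) • z)
    have e₁ : Φ xstar - (Φ (xstar - z) + w) = Φ z - w := by
      rw [map_sub]; abel
    have e₂ : Φ (xstar + (-t) • z) - (Φ (xstar - z) + w) = (Φ z - w) - t • Φ z := by
      rw [map_add, map_sub, map_smul, neg_smul]; abel
    have hsharp : sharp (xstar + (-t) • z) ≤ sharp xstar + t * sharp z := by
      have := hs.triangle xstar ((-t) • z)
      rwa [hs.smul_eq, abs_neg, abs_of_pos ht] at this
    rw [e₁, e₂, norm_sub_sq_real (Φ z - w), real_inner_smul_right, inner_sub_left,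
      real_inner_self_eq_norm_sq, norm_smul, mul_pow, Real.norm_eq_abs, sq_abs,
      real_inner_comm] at h
    have h' := mul_le_mul_of_nonneg_left hsharp hlam
    refine le_of_mul_le_mul_left ?_ ht
    linarith
  by_contra! hlt
  set a := ‖Φ z‖ ^ 2
  set c := ⟪Φ z, w⟫ + lam * sharp z
  have ha : 0 ≤ a := sq_nonneg _
  have hd : 0 < a - c := sub_pos.2 hlt
  have h := key ((a - c) / (a + 1)) (by positivity)
  have hle : (a - c) / (a + 1) * a ≤ a - c := by
    rw [div_mul_eq_mul_div, div_le_iff₀ (by positivity)]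
    nlinarith
  linarith


theorem lasso_step3 {M : ℕ} (sharp : H → ℝ) (hs : IsNormOn sharp)
    (Φ : H →ₗ[ℝ] EuclideanSpace ℝ (Fin M))
    (κ : ℝ) (hκ : κ ∈ Set.Ioo (0 : ℝ) 1)
    (lam : ℝ) (hlam : 0 < lam)
    (xnat : H) (ω : EuclideanSpace ℝ (Fin M))
    (hω : dualNorm sharp ((LinearMap.adjoint Φ) ω) ≤ κ * lam)
    (xstar : H)
    (hmin : ∀ x : H,
      (1 / 2) * ‖Φ xstar - (Φ xnat + ω)‖ ^ 2 + lam * sharp xstar ≤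
        (1 / 2) * ‖Φ x - (Φ xnat + ω)‖ ^ 2 + lam * sharp x)
    (z : H) (hz : z = xstar - xnat) :
    ‖Φ z‖ ^ 2 ≤ (1 + κ) * lam * sharp z := by
  obtain rfl : xnat = xstar - z := by rw [hz, sub_sub_cancel]
  have h := norm_sq_le_inner_add_of_forall_le hs Φ hlam.le xstar z ω hmin
  have hdual : ⟪Φ z, ω⟫ ≤ κ * lam * sharp z :=
    calc ⟪Φ z, ω⟫ = ⟪LinearMap.adjoint Φ ω, z⟫ := by
          rw [LinearMap.adjoint_inner_left, real_inner_comm]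
      _ ≤ |⟪LinearMap.adjoint Φ ω, z⟫| := le_abs_self _
      _ ≤ dualNorm sharp (LinearMap.adjoint Φ ω) * sharp z := hs.abs_inner_le_dualNorm_mul _ _
      _ ≤ κ * lam * sharp z := mul_le_mul_of_nonneg_right hω (hs.nonneg z)
  linarith
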